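/- arXiv:2107.12543 — 5 statements merged into one kernel-verified Lean document; each statement's English description precedes it below -/
import Mathlib

section
/- Let p be a prime and for 0 ≤ n ≤ p−1 define Φ_n(z) = z^n + (1/(p−n))·Σ_{k=0}^{n−1} z^k, with reversed polynomial Φ_n*(z) = 1 + (1/(p−n))·Σ_{k=1}^{n} z^k. Then for all 0 ≤ n ≤ p−2 the Szegő recurrence Φ_{n+1}(z) = z·Φ_n(z) + (1/(p−n−1))·Φ_n*(z) holds; that is, the Verblunsky parameters of this family are a_n = −1/(p−n−1). -/
open Finset

/-- For a prime `p`, the Ramanujan cyclotomic POPUC `Φ_n(z) = z^n + (1/(p-n))·Σ_{k<n} z^k`,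
with reversed polynomials `Φ_n*(z) = 1 + (1/(p-n))·Σ_{k=1}^{n} z^k`, satisfy for all
`0 ≤ n ≤ p - 2` the Szegő recurrence `Φ_{n+1}(z) = z·Φ_n(z) + (1/(p-n-1))·Φ_n*(z)`;
i.e. the Verblunsky parameters are `a_n = -1/(p-n-1)`. -/
theorem ramanujan_popuc_cyclotomic_prime_szego
    (p : ℕ) (hp : p.Prime) (n : ℕ) (hn : n ≤ p - 2) (z : ℂ) :
    z ^ (n + 1) + (1 / ((p : ℂ) - ((n : ℂ) + 1))) * ∑ k ∈ Finset.range (n + 1), z ^ k =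
      z * (z ^ n + (1 / ((p : ℂ) - (n : ℂ))) * ∑ k ∈ Finset.range n, z ^ k) +
        (1 / ((p : ℂ) - (n : ℂ) - 1)) *
          (1 + (1 / ((p : ℂ) - (n : ℂ))) * ∑ k ∈ Finset.Icc 1 n, z ^ k) := by
  have hIcc : ∑ k ∈ Finset.Icc 1 n, z ^ k = z * ∑ k ∈ Finset.range n, z ^ k := by
    clear hn
    induction n with
    | zero => simp
    | succ m ih =>
      rw [Finset.sum_Icc_succ_top (by omega), ih, Finset.sum_range_succ]
      ring
  have hrange : ∑ k ∈ Finset.range (n + 1), z ^ k = z * ∑ k ∈ Finset.range n, z ^ k + 1 := by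
    rw [Finset.sum_range_succ', Finset.mul_sum]
    simp [pow_succ']
  obtain ⟨m, rfl⟩ : ∃ m, p = n + 2 + m := ⟨p - 2 - n, by have := hp.two_le; omega⟩
  have hm₁ : (m : ℂ) + 1 ≠ 0 := by exact_mod_cast m.succ_ne_zero
  have hm₂ : (m : ℂ) + 2 ≠ 0 := by exact_mod_cast (m + 1).succ_ne_zero
  have hsub₁ : ((n + 2 + m : ℕ) : ℂ) - (n + 1) = m + 1 := by push_cast; ring
  have hsub₂ : ((n + 2 + m : ℕ) : ℂ) - n = m + 2 := by push_cast; ring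
  have hsub₃ : (m : ℂ) + 2 - 1 = m + 1 := by ring
  rw [hIcc, hrange, hsub₁, hsub₂, hsub₃]
  field_simp
  ring
end

section
/- For every integer n ≥ 0, the single-moment polynomials Φ̃_n(z) = (1/(n+1))·Σ_{k=0}^{n} (k+1)·z^k, whose reversed polynomials are Φ̃_n*(z) = (1/(n+1))·Σ_{k=0}^{n} (n+1−k)·z^k, satisfy the Szegő recurrence Φ̃_{n+1}(z) = z·Φ̃_n(z) + (1/(n+2))·Φ̃_n*(z); that is, their Verblunsky parameters are ã_n = −1/(n+2). -/
open Finset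

/-- The single-moment polynomials `Φ̃_n(z) = (1/(n+1))·Σ_{k=0}^{n} (k+1)·z^k`, whose
reversed polynomials are `Φ̃_n*(z) = (1/(n+1))·Σ_{k=0}^{n} (n+1-k)·z^k`, satisfy the
Szegő recurrence `Φ̃_{n+1}(z) = z·Φ̃_n(z) + (1/(n+2))·Φ̃_n*(z)`; i.e. their Verblunsky
parameters are `ã_n = -1/(n+2)`. -/
theorem single_moment_polynomials_szego (n : ℕ) (z : ℂ) :
    (1 / ((n : ℂ) + 2)) * ∑ k ∈ Finset.range (n + 2), ((k : ℂ) + 1) * z ^ k =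
      z * ((1 / ((n : ℂ) + 1)) * ∑ k ∈ Finset.range (n + 1), ((k : ℂ) + 1) * z ^ k) +
        (1 / ((n : ℂ) + 2)) *
          ((1 / ((n : ℂ) + 1)) * ∑ k ∈ Finset.range (n + 1), ((n : ℂ) + 1 - (k : ℂ)) * z ^ k) := by
  have h_shift : z * ∑ k ∈ Finset.range (n + 1), ((k : ℂ) + 1) * z ^ k =
      ∑ k ∈ Finset.range (n + 2), (k : ℂ) * z ^ k := by
    rw [Finset.sum_range_succ' _ (n + 1), Finset.mul_sum]
    simp only [Nat.cast_zero, zero_mul, add_zero]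
    refine Finset.sum_congr rfl fun k _ => ?_
    push_cast
    ring
  have h_extend : ∑ k ∈ Finset.range (n + 1), ((n : ℂ) + 1 - (k : ℂ)) * z ^ k =
      ∑ k ∈ Finset.range (n + 2), ((n : ℂ) + 1 - (k : ℂ)) * z ^ k := by
    simp [Finset.sum_range_succ _ (n + 1)]
  have hn1 : (n : ℂ) + 1 ≠ 0 := by exact_mod_cast Nat.succ_ne_zero n
  have hn2 : (n : ℂ) + 2 ≠ 0 := by exact_mod_cast Nat.succ_ne_zero (n + 1)
  rw [mul_left_comm z, h_shift, h_extend]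
  simp only [Finset.mul_sum, ← Finset.sum_add_distrib]
  refine Finset.sum_congr rfl fun k _ => ?_
  field_simp
  ring
end

section
/- Let p be an odd prime. For 2 ≤ n ≤ p define Φ̃_n(z) = z^n + ((2p−n)/(2p−n+1))·z^{n−1} + (−1)^n/(2p−n+1), with reversed polynomial Φ̃_n*(z) = 1 + ((2p−n)/(2p−n+1))·z + ((−1)^n/(2p−n+1))·z^n. Then for all 2 ≤ n ≤ p−1 the Szegő recurrence Φ̃_{n+1}(z) = z·Φ̃_n(z) − ã_n·Φ̃_n*(z) holds with ã_n = (−1)^n/(2p−n). (These are the Sturmian POPUC associated with the anti-cyclotomic polynomial A_{2p}(z) = z^{p+1} + z^p − z − 1.) -/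
/-- For an odd prime `p`, the Sturmian POPUC of the anti-cyclotomic polynomial `A_{2p}`,
`Φ̃_n(z) = z^n + ((2p-n)/(2p-n+1))·z^{n-1} + (-1)^n/(2p-n+1)` (for `2 ≤ n ≤ p`), with
reversed polynomials `Φ̃_n*(z) = 1 + ((2p-n)/(2p-n+1))·z + ((-1)^n/(2p-n+1))·z^n`,
satisfy for all `2 ≤ n ≤ p - 1` the Szegő recurrence
`Φ̃_{n+1}(z) = z·Φ̃_n(z) - ã_n·Φ̃_n*(z)` with `ã_n = (-1)^n/(2p-n)`. -/
theorem sturmian_anticyclotomic_szego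
    (p : ℕ) (hp : p.Prime) (hodd : Odd p) (n : ℕ) (hn2 : 2 ≤ n) (hn : n ≤ p - 1) (z : ℂ) :
    z ^ (n + 1) + ((2 * (p : ℂ) - ((n : ℂ) + 1)) / (2 * (p : ℂ) - ((n : ℂ) + 1) + 1)) * z ^ n +
        (-1 : ℂ) ^ (n + 1) / (2 * (p : ℂ) - ((n : ℂ) + 1) + 1) =
      z * (z ^ n + ((2 * (p : ℂ) - (n : ℂ)) / (2 * (p : ℂ) - (n : ℂ) + 1)) * z ^ (n - 1) +
          (-1 : ℂ) ^ n / (2 * (p : ℂ) - (n : ℂ) + 1)) -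
        ((-1 : ℂ) ^ n / (2 * (p : ℂ) - (n : ℂ))) *
          (1 + ((2 * (p : ℂ) - (n : ℂ)) / (2 * (p : ℂ) - (n : ℂ) + 1)) * z +
            ((-1 : ℂ) ^ n / (2 * (p : ℂ) - (n : ℂ) + 1)) * z ^ n) := by
  obtain ⟨m, hm⟩ : ∃ m : ℕ, 2 * p = n + (m + 1) := ⟨2 * p - n - 1, by
    have := hp.two_le
    omega⟩
  have hmC : 2 * (p : ℂ) = n + (m + 1) := by exact_mod_cast hm
  have hm₁ : (m : ℂ) + 1 ≠ 0 := by exact_mod_cast m.succ_ne_zero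
  have hm₂ : (m : ℂ) + 1 + 1 ≠ 0 := by exact_mod_cast (m + 1).succ_ne_zero
  have hsub : 2 * (p : ℂ) - n = m + 1 := by rw [hmC]; ring
  have hsub' : 2 * (p : ℂ) - (n + 1) = m := by rw [hmC]; ring
  have hz : z ^ n = z * z ^ (n - 1) := by rw [← pow_succ', Nat.sub_add_cancel (by omega)]
  have hsign : ((-1 : ℂ) ^ n) ^ 2 = 1 := by rw [← pow_mul, mul_comm, pow_mul]; simp
  rw [hsub, hsub', pow_succ z, pow_succ (-1 : ℂ), hz]
  generalize (-1 : ℂ) ^ n = ε at hsign ⊢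
  field_simp
  linear_combination (z * z ^ (n - 1)) * hsign
end

section
/- Let p be an odd prime. The Ramanujan anti-cyclotomic polynomials Φ_n(z) = z^n + (1/(n+p))·Σ_{k=0}^{n−1} (−1)^{n−1−k}·z^k, with reversed polynomials Φ_n*(z) = z^n·Φ_n(1/z), satisfy for all 0 ≤ n ≤ p−1 the Szegő recurrence Φ_{n+1}(z) = z·Φ_n(z) − a_n·Φ_n*(z) with Verblunsky parameters a_n = (−1)^{n+1}/(n+p+1). -/
open Finset

/-- Splitting off the constant term of the alternating sum `∑_{k ≤ n} (-1)^{n-k} z^k`. -/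
lemma sum_range_succ_neg_one_pow_sub_mul_pow {R : Type*} [CommRing R] (n : ℕ) (z : R) :
    ∑ k ∈ Finset.range (n + 1), (-1 : R) ^ (n - k) * z ^ k =
      z * ∑ k ∈ Finset.range n, (-1 : R) ^ (n - 1 - k) * z ^ k + (-1) ^ n := by
  rw [Finset.sum_range_succ', Finset.mul_sum]
  congr 1
  · refine Finset.sum_congr rfl fun k _ => ?_
    rw [show n - (k + 1) = n - 1 - k by omega]
    ring
  · simp

/-- The alternating sum over `1 ≤ k ≤ n` with signs counted from the bottom agrees, up to a
global sign, with the one whose signs are counted from the top. -/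
lemma sum_Icc_neg_one_pow_pred_mul_pow {R : Type*} [CommRing R] (n : ℕ) (z : R) :
    ∑ k ∈ Finset.Icc 1 n, (-1 : R) ^ (k - 1) * z ^ k =
      (-1) ^ (n + 1) * (z * ∑ k ∈ Finset.range n, (-1 : R) ^ (n - 1 - k) * z ^ k) := by
  rw [← Finset.Ico_add_one_right_eq_Icc, Finset.sum_Ico_eq_sum_range, Finset.mul_sum,
    Finset.mul_sum]
  refine Finset.sum_congr (by simp) fun k hk => ?_
  obtain ⟨m, rfl⟩ : ∃ m, n = k + 1 + m :=
    Nat.exists_eq_add_of_le (by simp at hk; omega)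
  rw [show 1 + k - 1 = k by omega, show k + 1 + m - 1 - k = m by omega]
  have hm : (-1 : R) ^ m * (-1) ^ m = 1 := by rw [← mul_pow]; simp
  linear_combination (-(-1) ^ k * z ^ (k + 1)) * hm

/-- For an odd prime `p`, the Ramanujan anti-cyclotomic polynomials
`Φ_n(z) = z^n + (1/(n+p))·Σ_{k=0}^{n-1} (-1)^{n-1-k}·z^k`, with reversed polynomials
`Φ_n*(z) = z^n·Φ_n(1/z) = 1 + (1/(n+p))·Σ_{k=1}^{n} (-1)^{k-1}·z^k`, satisfy for
`0 ≤ n ≤ p - 1` the Szegő recurrence `Φ_{n+1}(z) = z·Φ_n(z) - a_n·Φ_n*(z)` with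
Verblunsky parameters `a_n = (-1)^{n+1}/(n+p+1)`. -/
theorem ramanujan_anticyclotomic_szego
    (p : ℕ) (hp : p.Prime) (hodd : Odd p) (n : ℕ) (hn : n ≤ p - 1) (z : ℂ) :
    z ^ (n + 1) + (1 / ((n : ℂ) + 1 + (p : ℂ))) *
        ∑ k ∈ Finset.range (n + 1), (-1 : ℂ) ^ (n - k) * z ^ k =
      z * (z ^ n + (1 / ((n : ℂ) + (p : ℂ))) *
          ∑ k ∈ Finset.range n, (-1 : ℂ) ^ (n - 1 - k) * z ^ k) -
        ((-1 : ℂ) ^ (n + 1) / ((n : ℂ) + (p : ℂ) + 1)) *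
          (1 + (1 / ((n : ℂ) + (p : ℂ))) *
            ∑ k ∈ Finset.Icc 1 n, (-1 : ℂ) ^ (k - 1) * z ^ k) := by
  have hp0 : 0 < p := hp.pos
  have hN : (n : ℂ) + p ≠ 0 := by exact_mod_cast (by omega : n + p ≠ 0)
  have hN1 : (n : ℂ) + p + 1 ≠ 0 := by exact_mod_cast (by omega : n + p + 1 ≠ 0)
  rw [sum_range_succ_neg_one_pow_sub_mul_pow, sum_Icc_neg_one_pow_pred_mul_pow,
    add_right_comm (n : ℂ) 1 p]
  generalize ∑ k ∈ Finset.range n, (-1 : ℂ) ^ (n - 1 - k) * z ^ k = S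
  have hsign : (-1 : ℂ) ^ n * (-1) ^ n = 1 := by rw [← mul_pow]; simp
  rw [pow_succ (-1 : ℂ) n]
  generalize (-1 : ℂ) ^ n = e at hsign ⊢
  field_simp
  linear_combination (z * S) * hsign
end

section
/- Let p be an odd prime and for 0 ≤ n ≤ p−1 define Ψ_n(z) = z^n + ((−1)^n/(p−n))·Σ_{k=0}^{n−1} (−1)^k·z^k. Then for all 0 ≤ j < n ≤ p−1, the sum Σ_ζ Ψ_n(ζ)·ζ^{−j}, taken over all primitive (2p)-th roots of unity ζ in ℂ, equals 0. (These are the Ramanujan POPUC associated with the cyclotomic polynomial C_{2p}, whose trigonometric moments are σ_0 = 1 and σ_n = (−1)^{n+1}/(p−1) for 1 ≤ n ≤ p−1, and whose Verblunsky parameters are a_n = (−1)^n/(p−n−1).) -/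
open Polynomial Finset

/-- For odd `p`, negation carries primitive `p`-th roots of unity to primitive `2p`-th ones. -/
lemma IsPrimitiveRoot.neg_of_odd {p : ℕ} (hodd : Odd p) {η : ℂ} (h : IsPrimitiveRoot η p) :
    IsPrimitiveRoot (-η) (2 * p) := by
  have h2 : orderOf (-1 : ℂ) = 2 := by
    rw [orderOf_neg_one, if_neg (by simp [ringChar.eq_zero])]
  have key := (Commute.all (-1 : ℂ) η).orderOf_mul_eq_mul_orderOf_of_coprime
    (by rw [h2, ← h.eq_orderOf]; exact Nat.coprime_two_left.mpr hodd)
  rw [h2, ← h.eq_orderOf, neg_one_mul] at key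
  exact key ▸ IsPrimitiveRoot.orderOf (-η)

/-- For odd `p`, negation carries primitive `2p`-th roots of unity to primitive `p`-th ones. -/
lemma IsPrimitiveRoot.neg_of_two_mul_odd {p : ℕ} (hodd : Odd p) {ζ : ℂ}
    (h : IsPrimitiveRoot ζ (2 * p)) : IsPrimitiveRoot (-ζ) p := by
  have hsq : (ζ ^ p) ^ 2 = 1 := by rw [← pow_mul, mul_comm, h.pow_eq_one]
  have hp : ζ ^ p = -1 := (eq_or_eq_neg_of_sq_eq_sq _ 1 (by rw [hsq, one_pow])).resolve_left
    (h.pow_ne_one_of_pos_of_lt hodd.pos.ne' (by have := hodd.pos; omega))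
  refine ⟨by rw [hodd.neg_pow, hp, neg_neg], fun l hl => ?_⟩
  refine Nat.dvd_of_mul_dvd_mul_left two_pos (h.dvd_of_pow_eq_one _ ?_)
  rw [pow_mul, ← neg_sq, ← pow_mul, mul_comm, pow_mul, hl, one_pow]

/-- For odd `p`, power sums over primitive `2p`-th roots reduce to primitive `p`-th roots. -/
lemma sum_primitiveRoots_two_mul_zpow {p : ℕ} (hodd : Odd p) (m : ℤ) :
    ∑ ζ ∈ primitiveRoots (2 * p) ℂ, ζ ^ m = (-1) ^ m * ∑ η ∈ primitiveRoots p ℂ, η ^ m := by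
  have hpos := hodd.pos
  rw [mul_sum]
  refine sum_nbij' (fun z => -z) (fun z => -z) ?_ ?_ (by simp) (by simp) ?_
  · intro ζ hζ
    rw [mem_primitiveRoots (by omega)] at hζ ⊢
    exact hζ.neg_of_two_mul_odd hodd
  · intro η hη
    rw [mem_primitiveRoots (by omega)] at hη ⊢
    exact hη.neg_of_odd hodd
  · intro ζ _
    rw [← mul_zpow, neg_one_mul, neg_neg]

/-- The Ramanujan sum for a prime `p`. -/
lemma sum_primitiveRoots_prime_zpow {p : ℕ} (hp : p.Prime) (m : ℤ) :
    ∑ η ∈ primitiveRoots p ℂ, η ^ m = (if (p : ℤ) ∣ m then (p : ℂ) else 0) - 1 := by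
  have : NeZero p := ⟨hp.ne_zero⟩
  obtain ⟨μ, hμ⟩ : ∃ μ : ℂ, IsPrimitiveRoot μ p := ⟨_, Complex.isPrimitiveRoot_exp p hp.ne_zero⟩
  have hsum : ∑ η ∈ primitiveRoots p ℂ, η ^ m = ∑ i ∈ (range p).erase 0, (μ ^ m) ^ i := by
    symm
    refine sum_nbij (fun i => μ ^ i) ?_ ?_ ?_ ?_
    · intro i hi
      rw [mem_erase, mem_range] at hi
      rw [mem_primitiveRoots hp.pos]
      exact hμ.pow_of_coprime i (hp.coprime_iff_not_dvd.mpr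
        (Nat.not_dvd_of_pos_of_lt (Nat.pos_of_ne_zero hi.1) hi.2)).symm
    · intro i hi k hk hik
      simp only [coe_erase, coe_range, Set.mem_sdiff, Set.mem_Iio] at hi hk
      exact hμ.pow_inj hi.1 hk.1 hik
    · intro η hη
      rw [mem_coe, mem_primitiveRoots hp.pos] at hη
      obtain ⟨i, hi, rfl⟩ := hμ.eq_pow_of_pow_eq_one hη.pow_eq_one
      refine ⟨i, ?_, rfl⟩
      rw [mem_coe, mem_erase, mem_range]
      refine ⟨?_, hi⟩
      rintro rfl
      rw [pow_zero] at hη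
      exact hp.ne_one (hη.unique IsPrimitiveRoot.one)
    · intro i _
      rw [← zpow_natCast, ← zpow_natCast, ← zpow_mul, ← zpow_mul, mul_comm]
  rw [hsum, sum_erase_eq_sub (mem_range.mpr hp.pos), pow_zero]
  congr 1
  split_ifs with hm
  · simp [(hμ.zpow_eq_one_iff_dvd m).mpr hm]
  · have hne : μ ^ m ≠ 1 := fun h => hm ((hμ.zpow_eq_one_iff_dvd m).mp h)
    rw [geom_sum_eq hne, ← zpow_natCast, ← zpow_mul, mul_comm, zpow_mul, zpow_natCast,
      hμ.pow_eq_one, one_zpow, sub_self, zero_div]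

/-- For an odd prime `p`, the Ramanujan POPUC of the cyclotomic polynomial `C_{2p}`,
`Ψ_n(z) = z^n + ((-1)^n/(p-n))·Σ_{k=0}^{n-1} (-1)^k·z^k`, satisfy for `0 ≤ j < n ≤ p - 1`
`Σ_ζ Ψ_n(ζ)·ζ^{-j} = 0`, the sum over all primitive `(2p)`-th roots of unity `ζ` in `ℂ`. -/
theorem ramanujan_popuc_cyclotomic_two_mul_prime_orthogonality
    (p : ℕ) (hp : p.Prime) (hodd : Odd p) (n j : ℕ) (hj : j < n) (hn : n ≤ p - 1) :
    ∑ ζ ∈ primitiveRoots (2 * p) ℂ,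
      (ζ ^ n + ((-1 : ℂ) ^ n / ((p : ℂ) - (n : ℂ))) *
          ∑ k ∈ Finset.range n, (-1 : ℂ) ^ k * ζ ^ k) * ζ ^ (-(j : ℤ)) = 0 := by
  have hpos := hp.pos
  have hpn : (p : ℂ) - n ≠ 0 := sub_ne_zero.mpr (by exact_mod_cast (by omega : p ≠ n))
  -- Moments: the only multiple of `p` among the exponents `k - j` with `k ≤ n` is `0`.
  have moment (k : ℕ) (hk : k ≤ n) : ∑ ζ ∈ primitiveRoots (2 * p) ℂ, ζ ^ k * ζ ^ (-(j : ℤ)) =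
      (-1) ^ k * (-1) ^ j * ((if k = j then (p : ℂ) else 0) - 1) := by
    have hdvd : (p : ℤ) ∣ (k : ℤ) - j ↔ k = j := by
      refine ⟨fun h => ?_, fun h => by simp [h]⟩
      have := Int.eq_zero_of_abs_lt_dvd h (by rw [abs_lt]; omega)
      omega
    have hsign : (-1 : ℂ) ^ ((k : ℤ) - j) = (-1) ^ k * (-1) ^ j := by
      rw [zpow_sub₀ (by norm_num), zpow_natCast, zpow_natCast, div_eq_mul_inv, ← inv_pow,
        inv_neg_one]
    calc _ = ∑ ζ ∈ primitiveRoots (2 * p) ℂ, ζ ^ ((k : ℤ) - j) := by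
          refine sum_congr rfl fun ζ hζ => ?_
          have h0 : ζ ≠ 0 := (isPrimitiveRoot_of_mem_primitiveRoots hζ).ne_zero (by omega)
          rw [sub_eq_add_neg, zpow_add₀ h0, zpow_natCast]
      _ = _ := by
          rw [sum_primitiveRoots_two_mul_zpow hodd, sum_primitiveRoots_prime_zpow hp, hsign]
          simp only [hdvd]
  have hinner : ∑ k ∈ range n, (-1 : ℂ) ^ k *
      ∑ ζ ∈ primitiveRoots (2 * p) ℂ, ζ ^ k * ζ ^ (-(j : ℤ)) = (-1) ^ j * (p - n) := by
    calc _ = ∑ k ∈ range n, (-1 : ℂ) ^ j * ((if k = j then (p : ℂ) else 0) - 1) := by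
          refine sum_congr rfl fun k hk => ?_
          rw [moment k (mem_range.mp hk).le, ← mul_assoc, ← mul_assoc, ← mul_pow]
          norm_num
      _ = _ := by
          rw [← mul_sum, sum_sub_distrib, sum_ite_eq', if_pos (mem_range.mpr hj)]
          simp
  calc _ = ∑ ζ ∈ primitiveRoots (2 * p) ℂ, ζ ^ n * ζ ^ (-(j : ℤ)) +
        (-1 : ℂ) ^ n / ((p : ℂ) - n) * ∑ k ∈ range n, (-1 : ℂ) ^ k *
          ∑ ζ ∈ primitiveRoots (2 * p) ℂ, ζ ^ k * ζ ^ (-(j : ℤ)) := by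
        simp only [mul_sum, add_mul, sum_add_distrib, sum_mul]
        rw [sum_comm]
        simp only [mul_assoc]
    _ = 0 := by
        rw [hinner, moment n le_rfl, if_neg hj.ne']
        field_simp
        ring
end
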